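/- Let s = 2. Suppose X = {X₁,…,X_m} ⊂ ℤ² is η-coplanar and Y = {Y₁,…,Y_{m'}} ⊂ ℤ² is η'-coplanar, they generate the same cone C_X = C_Y, and they define the same directional growth function γ_X = γ_Y. Then η = c·η' for some real c > 0; in other words, the line containing X and the line containing Y are parallel. -/

import Mathlib

open scoped BigOperators RealInnerProductSpace
open Filter Topology

noncomputable section

/-- `Euc s` is the Euclidean space `ℝ^s`. -/
abbrev Euc (s : ℕ) := EuclideanSpace ℝ (Fin s)

/-- The additive semigroup `X₁ℕ + ⋯ + X_mℕ` generated by the vectors `X j`. -/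
def sgOf {s : ℕ} {ι : Type*} [Fintype ι] (X : ι → Euc s) : Set (Euc s) :=
  {z | ∃ u : ι → ℕ, ∑ j, (u j : ℝ) • X j = z}

/-- The lattice `X₁ℤ + ⋯ + X_mℤ` generated by the vectors `X j`. -/
def latOf {s : ℕ} {ι : Type*} [Fintype ι] (X : ι → Euc s) : Set (Euc s) :=
  {z | ∃ u : ι → ℤ, ∑ j, (u j : ℝ) • X j = z}

/-- The convex cone `X₁ℝ⁺ + ⋯ + X_mℝ⁺` generated by the vectors `X j`. -/
def coneOf {s : ℕ} {ι : Type*} [Fintype ι] (X : ι → Euc s) : Set (Euc s) :=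
  {x | ∃ c : ι → ℝ, (∀ j, 0 ≤ c j) ∧ ∑ j, c j • X j = x}

/-- The multiplicity of `z`: the number of finite words `i₁…i_n` with
`X_{i₁} + ⋯ + X_{i_n} = z`. -/
def mult {s : ℕ} {ι : Type*} [Fintype ι] (X : ι → Euc s) (z : Euc s) : ℕ :=
  Set.ncard {w : List ι | (w.map X).sum = z}

/-- The multiplicity extended to the cone: the minimum of `mult X z` over points
`z` of the semigroup nearest to `x`. -/
def multC {s : ℕ} {ι : Type*} [Fintype ι] (X : ι → Euc s) (x : Euc s) : ℕ :=
  sInf {n | ∃ z ∈ sgOf X, dist x z = Metric.infDist x (sgOf X) ∧ mult X z = n}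

/-- All the vectors `X j` have integer coordinates. -/
def IntegralVecs {s : ℕ} {ι : Type*} (X : ι → Euc s) : Prop :=
  ∀ j i, ∃ n : ℤ, X j i = (n : ℝ)

/-- The entropy `h(p) = -∑ p_j log p_j` of a probability vector. -/
def entropy {m : ℕ} (p : Fin m → ℝ) : ℝ := -∑ j, p j * Real.log (p j)

/-- The `p`-th iteration of `X`: all sums `X_{ω₁} + ⋯ + X_{ω_p}` over words `ω`. -/
def iter {s m : ℕ} (X : Fin m → Euc s) (p : ℕ) : (Fin p → Fin m) → Euc s :=
  fun ω => ∑ i, X (ω i)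

open Polynomial in
theorem dvd_of_integral_aux {A : Type*} [CommRing A] (φ : ℝ[X] →+* A) (hφ : Function.Injective φ)
    (F G : ℝ[X]) (g : A) (hg : φ.IsIntegralElem g) (h : φ F * g = φ G) :
    ∃ n : ℕ, F ∣ G ^ n := by
  obtain ⟨p, hp, hr⟩ := hg
  refine ⟨p.natDegree, ?_⟩
  have h1 := scaleRoots_eval₂_eq_zero (s := F) φ hr
  rw [h, eval₂_hom] at h1
  have h2 : (p.scaleRoots F).eval G = 0 := hφ (by rw [h1, map_zero])
  rw [eval_eq_sum_range, natDegree_scaleRoots, Finset.sum_range_succ] at h2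
  simp only [coeff_scaleRoots, hp.coeff_natDegree, Nat.sub_self, pow_zero, mul_one, one_mul] at h2
  rw [eq_neg_of_add_eq_zero_right h2]
  refine (Finset.dvd_sum fun i hi => ?_).neg_right
  have : p.natDegree - i ≠ 0 := by have := Finset.mem_range.1 hi; omega
  exact ((dvd_pow_self F this).mul_left _).mul_right _

open Polynomial in
theorem alg_contra {m m' : ℕ} (e : Fin m → ℕ) (j₁ j₂ : Fin m) (he : e j₁ ≠ e j₂)
    (n d : Fin m' → ℕ) (D : ℕ) (hD : 0 < D) (N : ℕ) (hn : ∀ j, 0 < n j) (hN : ∀ j, n j ≤ N)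
    (j₀ : Fin m') (hj₀ : n j₀ = N) (hd : ∀ j, n j = N → d j = d j₀)
    (H : ∀ t y : ℝ, 0 < t → 0 < y → y ^ D = ∑ j, t ^ e j → ∑ j, y ^ (N - n j) * t ^ d j = y ^ N) :
    False := by
  classical
  let φ : ℝ[X] →+* (Set.Ioi (0:ℝ) → ℝ) := RingHom.pi fun t => evalRingHom (t : ℝ)
  have φa : ∀ p t, φ p t = p.eval (t : ℝ) := fun p t => rfl
  have hφ : Function.Injective φ := by
    intro p q hpq
    apply Polynomial.eq_of_infinite_eval_eq
    refine (Set.Ioi_infinite (0:ℝ)).mono fun t ht => ?_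
    exact congrFun hpq ⟨t, ht⟩
  let F : ℝ[X] := ∑ j, X ^ e j
  have hF : ∀ t : ℝ, F.eval t = ∑ j, t ^ e j := fun t => by simp [F, eval_finsetSum]
  have hFpos : ∀ t : ℝ, 0 < t → 0 < F.eval t := fun t ht => by
    rw [hF]; exact Finset.sum_pos (fun j _ => pow_pos ht _) ⟨j₁, Finset.mem_univ _⟩
  let y : Set.Ioi (0:ℝ) → ℝ := fun t => (F.eval (t:ℝ)) ^ ((D:ℝ)⁻¹)
  have hypos : ∀ t, 0 < y t := fun t => Real.rpow_pos_of_pos (hFpos _ t.2) _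
  have hyD : y ^ D = φ F := by
    ext t
    simp only [Pi.pow_apply, φa, y]
    exact Real.rpow_inv_natCast_pow (hFpos _ t.2).le hD.ne'
  have hyint : φ.IsIntegralElem y := by
    refine ⟨X ^ D - C F, monic_X_pow_sub_C F hD.ne', ?_⟩
    simp [hyD]
  have hN0 : 0 < N := hj₀ ▸ hn j₀
  let S := Finset.univ.filter fun j => n j = N
  let h : Set.Ioi (0:ℝ) → ℝ := y ^ (N - 1) -
    ∑ j ∈ Finset.univ.filter (fun j => ¬ n j = N), y ^ (N - n j - 1) * φ (X ^ d j)
  let _ := φ.toAlgebra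
  have hyint' : IsIntegral ℝ[X] y := hyint
  have hhint : IsIntegral ℝ[X] h := by
    refine (hyint'.pow _).sub (IsIntegral.sum _ fun j _ => (hyint'.pow _).mul ?_)
    exact isIntegral_algebraMap (R := ℝ[X]) (x := X ^ d j)
  have hyh : y * h = φ (C (S.card : ℝ) * X ^ d j₀) := by
    ext t
    have h1 := H t (y t) t.2 (hypos t) (by rw [← hF, ← φa, ← hyD]; rfl)
    rw [← Finset.sum_filter_add_sum_filter_not _ (fun j => n j = N)] at h1
    have h2 : ∑ j ∈ Finset.univ.filter (fun j => n j = N), y t ^ (N - n j) * (t:ℝ) ^ d j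
        = S.card * (t:ℝ) ^ d j₀ := by
      rw [Finset.sum_congr rfl (g := fun _ => (t:ℝ) ^ d j₀)]
      · simp [S]
      · intro j hj
        have hj := (Finset.mem_filter.1 hj).2
        simp [hj, hd j hj]
    rw [h2] at h1
    simp only [Pi.mul_apply, h, Pi.sub_apply, Finset.sum_apply, Pi.pow_apply, φa, eval_mul, eval_pow,
      eval_C, eval_X]
    rw [mul_sub, ← pow_succ', Nat.sub_add_cancel hN0, Finset.mul_sum, ← h1,
      add_sub_assoc, sub_eq_zero.2, add_zero]
    refine Finset.sum_congr rfl fun j hj => ?_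
    have hj := (Finset.mem_filter.1 hj).2
    have := hN j
    rw [← mul_assoc, ← pow_succ']
    congr 2
    omega
  obtain ⟨k, hk⟩ := dvd_of_integral_aux φ hφ F ((C (S.card : ℝ) * X ^ d j₀) ^ D) (h ^ D)
    (hhint.pow D) (by rw [← hyD, ← mul_pow, hyh, map_pow])
  have hS : (S.card : ℝ) ≠ 0 := by
    have : 0 < S.card := Finset.card_pos.2 ⟨j₀, by simp [S, hj₀]⟩
    positivity
  rw [← pow_mul, mul_pow, ← C_pow, ← pow_mul] at hk
  have hu : IsUnit (C ((S.card : ℝ) ^ (D * k))) := isUnit_C.2 (IsUnit.mk0 _ (pow_ne_zero _ hS))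
  rw [hu.dvd_mul_left, dvd_prime_pow prime_X] at hk
  obtain ⟨i, -, hi⟩ := hk
  obtain ⟨u, hu⟩ := hi.symm
  obtain ⟨r, hr, hr'⟩ := Polynomial.isUnit_iff.1 u.isUnit
  have key : ∀ j, e j = i := by
    intro j
    by_contra hne
    have h1 : F.coeff (e j) = 0 := by
      rw [← hu, ← hr', coeff_mul_C, coeff_X_pow, if_neg hne, zero_mul]
    have h2 : F.coeff (e j) = ∑ l, if e j = e l then (1:ℝ) else 0 := by
      simp [F, coeff_X_pow]
    have h3 : (0:ℝ) < ∑ l, if e j = e l then (1:ℝ) else 0 :=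
      Finset.sum_pos' (fun l _ => by split_ifs <;> norm_num) ⟨j, Finset.mem_univ _, by simp⟩
    linarith
  exact he ((key j₁).trans (key j₂).symm)

/-- The partition function of `X`. -/
def PP {m : ℕ} (X : Fin m → Euc 2) (l : Euc 2) : ℝ := ∑ j, Real.exp (-⟪l, X j⟫)

theorem inner_list_sum {m : ℕ} (X : Fin m → Euc 2) (η : Euc 2) (hη : ∀ j, ⟪η, X j⟫ = 1)
    (w : List (Fin m)) : ⟪η, (w.map X).sum⟫ = (w.length : ℝ) := by
  induction w with
  | nil => simp
  | cons a w ih => simp [inner_add_right, hη, ih, add_comm]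

theorem words_eq {m : ℕ} (X : Fin m → Euc 2) (η : Euc 2) (hη : ∀ j, ⟪η, X j⟫ = 1)
    (z : Euc 2) (n : ℕ) (hz : ⟪η, z⟫ = (n : ℝ)) :
    {w : List (Fin m) | (w.map X).sum = z} =
      (fun f : Fin n → Fin m => List.ofFn f) '' {f | ∑ i, X (f i) = z} := by
  ext w
  simp only [Set.mem_ofPred_eq, Set.mem_image]
  constructor
  · intro hw
    have : w.length = n := by
      have := inner_list_sum X η hη w
      rw [hw, hz] at this
      exact_mod_cast this.symm
    subst this
    refine ⟨w.get, ?_, List.ofFn_get w⟩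
    rw [← hw]
    conv_rhs => rw [← List.ofFn_get w, List.map_ofFn, List.sum_ofFn]
    rfl
  · rintro ⟨f, hf, rfl⟩
    rw [List.map_ofFn, List.sum_ofFn]
    exact hf

theorem words_finite {m : ℕ} (X : Fin m → Euc 2) (η : Euc 2) (hη : ∀ j, ⟪η, X j⟫ = 1)
    (z : Euc 2) : {w : List (Fin m) | (w.map X).sum = z}.Finite := by
  by_cases h : ∃ n : ℕ, ⟪η, z⟫ = (n : ℝ)
  · obtain ⟨n, hn⟩ := h
    rw [words_eq X η hη z n hn]
    exact (Set.toFinite _).image _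
  · convert Set.finite_empty
    ext w
    simp only [Set.mem_ofPred_eq, Set.mem_empty_iff_false, iff_false]
    rintro rfl
    exact h ⟨_, inner_list_sum X η hη w⟩

open Classical in
theorem mult_eq_card {m : ℕ} (X : Fin m → Euc 2) (η : Euc 2) (hη : ∀ j, ⟪η, X j⟫ = 1)
    (z : Euc 2) (n : ℕ) (hz : ⟪η, z⟫ = (n : ℝ)) :
    mult X z = (Finset.univ.filter fun f : Fin n → Fin m => ∑ i, X (f i) = z).card := by
  unfold mult
  rw [words_eq X η hη z n hz, Set.ncard_image_of_injective _ List.ofFn_injective,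
    ← Set.ncard_coe_finset]
  simp

theorem PP_pow {m : ℕ} (X : Fin m → Euc 2) (l : Euc 2) (n : ℕ) :
    PP X l ^ n = ∑ f : Fin n → Fin m, Real.exp (-⟪l, ∑ i, X (f i)⟫) := by
  unfold PP
  rw [Fintype.sum_pow]
  refine Finset.sum_congr rfl fun f _ => ?_
  rw [← Real.exp_sum, inner_sum, Finset.sum_neg_distrib]

theorem PP_nonneg {m : ℕ} (X : Fin m → Euc 2) (l : Euc 2) : 0 ≤ PP X l :=
  Finset.sum_nonneg fun _ _ => (Real.exp_pos _).le

theorem mult_le {m : ℕ} (X : Fin m → Euc 2) (η : Euc 2) (hη : ∀ j, ⟪η, X j⟫ = 1)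
    (l : Euc 2) (hl : PP X l ≤ 1) (z : Euc 2) : (mult X z : ℝ) ≤ Real.exp ⟪l, z⟫ := by
  classical
  by_cases h : ∃ w : List (Fin m), (w.map X).sum = z
  · obtain ⟨w, hw⟩ := h
    have hz := inner_list_sum X η hη w
    rw [hw] at hz
    rw [mult_eq_card X η hη z _ hz]
    set S := Finset.univ.filter fun f : Fin w.length → Fin m => ∑ i, X (f i) = z with hS
    have h1 : (S.card : ℝ) * Real.exp (-⟪l, z⟫) ≤ 1 := by
      calc (S.card : ℝ) * Real.exp (-⟪l, z⟫) = ∑ f ∈ S, Real.exp (-⟪l, ∑ i, X (f i)⟫) := by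
            rw [Finset.sum_congr rfl (g := fun _ => Real.exp (-⟪l, z⟫))]
            · simp
            · intro f hf
              rw [(Finset.mem_filter.1 hf).2]
        _ ≤ PP X l ^ w.length := by
            rw [PP_pow]
            exact Finset.sum_le_sum_of_subset_of_nonneg (Finset.subset_univ _)
              fun _ _ _ => (Real.exp_pos _).le
        _ ≤ 1 := pow_le_one₀ (PP_nonneg X l) hl
    rw [Real.exp_neg, ← div_eq_mul_inv, div_le_one (Real.exp_pos _)] at h1
    exact h1
  · have : {w : List (Fin m) | (w.map X).sum = z} = ∅ := by
      ext w; simp only [Set.mem_ofPred_eq, Set.mem_empty_iff_false, iff_false]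
      exact fun hw => h ⟨w, hw⟩
    unfold mult
    rw [this]
    simp [Real.exp_nonneg]

theorem mult_super {m : ℕ} (X : Fin m → Euc 2) (η : Euc 2) (hη : ∀ j, ⟪η, X j⟫ = 1)
    (z : Euc 2) (q : ℕ) : mult X z ^ q ≤ mult X ((q : ℝ) • z) := by
  induction q with
  | zero =>
    have : 0 < mult X ((0 : ℕ) • z) := by
      unfold mult
      rw [Set.ncard_pos (words_finite X η hη _)]
      exact ⟨[], by simp⟩
    simpa [Nat.one_le_iff_ne_zero, Nat.pos_iff_ne_zero] using this
  | succ q ih =>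
    calc mult X z ^ (q+1) = mult X z ^ q * mult X z := pow_succ _ _
      _ ≤ mult X ((q : ℝ) • z) * mult X z := Nat.mul_le_mul_right _ ih
      _ = mult X z * mult X ((q : ℝ) • z) := mul_comm _ _
      _ ≤ _ := by
        unfold mult
        rw [← Set.ncard_prod]
        refine Set.ncard_le_ncard_of_injOn (fun p : List (Fin m) × List (Fin m) => p.1 ++ p.2)
          ?_ ?_ (words_finite X η hη _)
        · rintro ⟨a, b⟩ ⟨ha, hb⟩
          simp only [Set.mem_ofPred_eq] at ha hb ⊢
          rw [List.map_append, List.sum_append, ha, hb]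
          push_cast
          module
        · rintro ⟨a, b⟩ ⟨ha, hb⟩ ⟨a', b'⟩ ⟨ha', hb'⟩ hab
          simp only [Set.mem_ofPred_eq] at ha hb ha' hb' hab
          have h1 := inner_list_sum X η hη a
          have h2 := inner_list_sum X η hη a'
          rw [ha] at h1
          rw [ha', h1] at h2
          have h3 : a.length = a'.length := by exact_mod_cast h2
          obtain ⟨rfl, rfl⟩ := List.append_inj hab h3
          rfl

theorem exists_big {m : ℕ} (X : Fin m → Euc 2) (η : Euc 2) (hη : ∀ j, ⟪η, X j⟫ = 1)
    (l : Euc 2) (hl : 1 < PP X l) :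
    ∃ z ∈ sgOf X, Real.exp ⟪l, z⟫ < mult X z := by
  classical
  by_contra! hcon
  have bound : ∀ n : ℕ, PP X l ^ n ≤ ((n : ℝ) + 1) ^ m := by
    intro n
    let T : (Fin n → Fin m) → (Fin m → Fin (n+1)) := fun f j =>
      ⟨(Finset.univ.filter fun i => f i = j).card, by
        have := Finset.card_le_univ (Finset.univ.filter fun i => f i = j)
        simp only [Fintype.card_fin] at this
        omega⟩
    let V : (Fin m → Fin (n+1)) → Euc 2 := fun u => ∑ j, ((u j : ℕ) : ℝ) • X j
    have hV : ∀ f, ∑ i, X (f i) = V (T f) := by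
      intro f
      rw [← Finset.sum_fiberwise (s := Finset.univ) (g := f)]
      refine Finset.sum_congr rfl fun j _ => ?_
      rw [Finset.sum_congr rfl (g := fun _ => X j)]
      · simp [T, Nat.cast_smul_eq_nsmul]
      · intro i hi; rw [(Finset.mem_filter.1 hi).2]
    rw [PP_pow, ← Finset.sum_fiberwise (s := Finset.univ) (g := T)]
    calc _ ≤ ∑ u : Fin m → Fin (n+1), (1 : ℝ) := by
          refine Finset.sum_le_sum fun u _ => ?_
          by_cases hu : ∃ f, T f = u
          · obtain ⟨f0, hf0⟩ := hu
            have hin : ⟪η, V u⟫ = (n : ℝ) := by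
              rw [← hf0, ← hV, inner_sum]; simp [hη]
            have h1 := hcon (V u) ⟨fun j => u j, rfl⟩
            rw [mult_eq_card X η hη _ n hin] at h1
            rw [Finset.sum_congr rfl (g := fun _ => Real.exp (-⟪l, V u⟫))]
            · rw [Finset.sum_const, nsmul_eq_mul, Real.exp_neg, ← div_eq_mul_inv,
                div_le_one (Real.exp_pos _)]
              refine le_trans ?_ h1
              norm_cast
              refine Finset.card_le_card fun f hf => ?_
              have := (Finset.mem_filter.1 hf).2
              simp [hV, this]
            · intro f hf
              rw [hV, (Finset.mem_filter.1 hf).2]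
          · rw [Finset.sum_eq_zero]
            · norm_num
            · intro f hf
              exact absurd ⟨f, (Finset.mem_filter.1 hf).2⟩ hu
      _ = ((n : ℝ) + 1) ^ m := by simp
  have hlim := tendsto_pow_const_div_const_pow_of_one_lt m hl
  have hlim2 := (hlim.comp (tendsto_add_atTop_nat 1))
  have h1 : ∀ᶠ n : ℕ in atTop, ((n + 1 : ℕ) : ℝ) ^ m / PP X l ^ (n+1) < (PP X l)⁻¹ :=
    hlim2.eventually (gt_mem_nhds (by positivity))
  obtain ⟨n, hn⟩ := h1.exists
  have h0 : 0 < PP X l := by linarith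
  rw [div_lt_iff₀ (by positivity), pow_succ', inv_mul_cancel_left₀ h0.ne'] at hn
  have := bound n
  push_cast at hn
  linarith

theorem sgOf_int {m : ℕ} (X : Fin m → Euc 2) (hint : IntegralVecs X) (z : Euc 2) (hz : z ∈ sgOf X)
    (i : Fin 2) : ∃ n : ℤ, z i = (n : ℝ) := by
  obtain ⟨u, rfl⟩ := hz
  choose c hc using hint
  refine ⟨∑ j, (u j : ℤ) * c j i, ?_⟩
  simp [hc]

theorem eq_of_dist_lt_one (a b : Euc 2) (ha : ∀ i, ∃ n : ℤ, a i = (n : ℝ))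
    (hb : ∀ i, ∃ n : ℤ, b i = (n : ℝ)) (h : dist a b < 1) : a = b := by
  ext i
  obtain ⟨p, hp⟩ := ha i
  obtain ⟨q, hq⟩ := hb i
  have h1 : ‖(a - b) i‖ ≤ ‖a - b‖ := PiLp.norm_apply_le _ _
  rw [← dist_eq_norm] at h1
  rw [PiLp.sub_apply, hp, hq, Real.norm_eq_abs] at h1
  have h2 : |(p : ℝ) - q| < 1 := lt_of_le_of_lt h1 h
  have h3 : |p - q| < 1 := by exact_mod_cast h2
  have : p = q := by rw [Int.abs_lt_one_iff] at h3; omega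
  rw [hp, hq, this]

theorem multC_near {m : ℕ} (X : Fin m → Euc 2) (hint : IntegralVecs X) (z x : Euc 2)
    (hz : z ∈ sgOf X) (h : dist x z < 1 / 2) : multC X x = mult X z := by
  have hu : ∀ z' ∈ sgOf X, dist x z' < 1 / 2 → z' = z := fun z' hz' h' =>
    eq_of_dist_lt_one _ _ (sgOf_int X hint z' hz') (sgOf_int X hint z hz) (by
      have := dist_triangle_left z' z x
      linarith)
  have h1 : dist x z = Metric.infDist x (sgOf X) := by
    apply le_antisymm _ (Metric.infDist_le_dist_of_mem hz)
    rw [Metric.le_infDist ⟨z, hz⟩]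
    intro z' hz'
    by_contra! hlt
    rw [hu z' hz' (hlt.trans h)] at hlt
    exact lt_irrefl _ hlt
  unfold multC
  have hset : {n | ∃ z ∈ sgOf X, dist x z = Metric.infDist x (sgOf X) ∧ mult X z = n}
      = {mult X z} := by
    ext n
    constructor
    · rintro ⟨z', hz', hd, rfl⟩
      rw [hu z' hz' (by rw [hd, ← h1]; exact h)]
      rfl
    · rintro rfl
      exact ⟨z, hz, h1, rfl⟩
  rw [hset]
  exact csInf_singleton _

theorem gamma_ge {m : ℕ} (X : Fin m → Euc 2) (hint : IntegralVecs X)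
    (η : Euc 2) (hη : ∀ j, ⟪η, X j⟫ = 1) (z : Euc 2) (hz : z ∈ sgOf X) (hz0 : z ≠ 0)
    (hm : 0 < mult X z) (g : ℝ)
    (hg : Tendsto (fun k : ℕ => Real.log (multC X ((k : ℝ) • (‖z‖⁻¹ • z))) / k) atTop (nhds g)) :
    Real.log (mult X z) / ‖z‖ ≤ g := by
  have hr : 0 < ‖z‖ := norm_pos_iff.2 hz0
  set L := Real.log (mult X z) / ‖z‖ with hL
  have hlog : 0 ≤ Real.log (mult X z) := Real.log_natCast_nonneg _
  have hL0 : 0 ≤ L := by positivity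
  have ht : Tendsto (fun k : ℕ => Real.log (multC X ((k : ℝ) • (‖z‖⁻¹ • z))) / k + (L / 2) / k)
      atTop (nhds (g + 0)) := hg.add (tendsto_const_div_atTop_nhds_zero_nat _)
  rw [add_zero] at ht
  refine ge_of_tendsto_of_frequently ht ?_
  rw [frequently_atTop]
  intro K
  obtain ⟨q, hq⟩ := exists_nat_gt (((K : ℝ) + 1) / ‖z‖)
  rw [div_lt_iff₀ hr] at hq
  set x := ((2 * q : ℕ) : ℝ) * ‖z‖ with hx
  have hxK : (K : ℝ) + 1 < x := by
    have : 0 ≤ (q : ℝ) * ‖z‖ := by positivity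
    rw [hx]; push_cast; linarith
  have hK0 : (0 : ℝ) ≤ K := Nat.cast_nonneg K
  set k := ⌊x + 1 / 2⌋₊ with hk
  have hk1 : (k : ℝ) ≤ x + 1 / 2 := Nat.floor_le (by linarith)
  have hk2 : x + 1 / 2 < k + 1 := Nat.lt_floor_add_one _
  have hkK : K < k := by
    have : (K : ℝ) < k := by linarith
    exact_mod_cast this
  have hne : (k : ℝ) ≠ x + 1 / 2 := by
    intro he
    obtain ⟨a, ha⟩ := sgOf_int X hint z hz 0
    obtain ⟨b, hb⟩ := sgOf_int X hint z hz 1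
    have hn : ‖z‖ ^ 2 = (a : ℝ) ^ 2 + (b : ℝ) ^ 2 := by
      rw [EuclideanSpace.norm_sq_eq]
      simp [Fin.sum_univ_two, ha, hb]
    have h1 : (2 * (k : ℝ) - 1) ^ 2 = 4 * (2 * q) ^ 2 * (a ^ 2 + b ^ 2) := by
      rw [he, ← hn, hx]; push_cast; ring
    have h2 : (2 * (k : ℤ) - 1) ^ 2 = 4 * (2 * q) ^ 2 * (a ^ 2 + b ^ 2) := by exact_mod_cast h1
    have h3 : 2 * (2 * (k : ℤ) ^ 2 - 2 * k - 2 * (2 * q) ^ 2 * (a ^ 2 + b ^ 2)) = -1 := by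
      linear_combination h2
    omega
  have hk1' : (k : ℝ) < x + 1 / 2 := lt_of_le_of_ne hk1 hne
  refine ⟨k, hkK.le, ?_⟩
  have hk0 : (0 : ℝ) < k := by exact_mod_cast (Nat.zero_le K).trans_lt hkK
  have hqz : ((2 * q : ℕ) : ℝ) • z ∈ sgOf X := by
    obtain ⟨u, hu⟩ := hz
    refine ⟨fun j => (2 * q) * u j, ?_⟩
    rw [← hu, Finset.smul_sum]
    refine Finset.sum_congr rfl fun j _ => ?_
    rw [smul_smul]; push_cast; rfl
  have hdist : dist ((k : ℝ) • (‖z‖⁻¹ • z)) (((2 * q : ℕ) : ℝ) • z) ≤ |(k : ℝ) - x| := by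
    have : (k : ℝ) • (‖z‖⁻¹ • z) - ((2 * q : ℕ) : ℝ) • z = ((k - x) * ‖z‖⁻¹) • z := by
      rw [hx, smul_smul, ← sub_smul]
      congr 1
      field_simp
    rw [dist_eq_norm, this, norm_smul, norm_mul, norm_inv, norm_norm, mul_assoc,
      inv_mul_cancel₀ hr.ne', mul_one, Real.norm_eq_abs]
  by_cases hlow : (k : ℝ) - x = -(1 / 2)
  · exfalso; linarith
  have hd2 : |(k : ℝ) - x| < 1 / 2 := by
    rw [abs_lt]
    exact ⟨lt_of_le_of_ne (by linarith) (Ne.symm hlow), by linarith⟩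
  rw [multC_near X hint _ _ hqz (hdist.trans_lt hd2)]
  have hs : Real.log (mult X z) * (2 * q : ℕ) ≤ Real.log (mult X (((2 * q : ℕ) : ℝ) • z)) := by
    rw [mul_comm, ← Real.log_pow]
    apply Real.log_le_log (by positivity)
    exact_mod_cast mult_super X η hη z (2 * q)
  rw [← add_div, le_div_iff₀ hk0]
  have h5 : Real.log (mult X z) * (2 * q : ℕ) = L * x := by
    rw [hL, hx]; field_simp
  nlinarith

theorem cone_inner_nonneg {m : ℕ} (X : Fin m → Euc 2) (l θ : Euc 2) (hl : PP X l ≤ 1)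
    (hθ : θ ∈ coneOf X) : 0 ≤ ⟪l, θ⟫ := by
  obtain ⟨c, hc, rfl⟩ := hθ
  rw [inner_sum]
  refine Finset.sum_nonneg fun j _ => ?_
  rw [inner_smul_right]
  refine mul_nonneg (hc j) ?_
  have : Real.exp (-⟪l, X j⟫) ≤ PP X l :=
    Finset.single_le_sum (f := fun j => Real.exp (-⟪l, X j⟫)) (fun _ _ => (Real.exp_pos _).le)
      (Finset.mem_univ j)
  have := this.trans hl
  rw [Real.exp_le_one_iff] at this
  linarith

theorem gamma_le {m : ℕ} (X : Fin m → Euc 2)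
    (η : Euc 2) (hη : ∀ j, ⟪η, X j⟫ = 1) (l : Euc 2) (hl : PP X l ≤ 1) (θ : Euc 2)
    (hθ : θ ∈ coneOf X) (g : ℝ)
    (hg : Tendsto (fun k : ℕ => Real.log (multC X ((k : ℝ) • θ)) / k) atTop (nhds g)) :
    g ≤ ⟪l, θ⟫ := by
  set B := ‖l‖ * ∑ j, ‖X j‖ with hB
  have hB0 : 0 ≤ B := by positivity
  have hpos := cone_inner_nonneg X l θ hl hθ
  have key : ∀ k : ℕ, Real.log (multC X ((k : ℝ) • θ)) ≤ k * ⟪l, θ⟫ + B := by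
    intro k
    have hR : 0 ≤ k * ⟪l, θ⟫ + B := by positivity
    unfold multC
    set S := {n | ∃ z ∈ sgOf X, dist ((k : ℝ) • θ) z = Metric.infDist ((k : ℝ) • θ) (sgOf X) ∧
      mult X z = n} with hS
    rcases S.eq_empty_or_nonempty with he | hne
    · rw [he]; simpa using hR
    · obtain ⟨z, hz, hd, hmz⟩ := Nat.sInf_mem hne
      rw [← hmz]
      rcases Nat.eq_zero_or_pos (mult X z) with h0 | h0
      · rw [h0]; simpa using hR
      · have h1 : Real.log (mult X z) ≤ ⟪l, z⟫ := by
          rw [Real.log_le_iff_le_exp (by exact_mod_cast h0)]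
          exact mult_le X η hη l hl z
        have h2 : dist ((k : ℝ) • θ) z ≤ ∑ j, ‖X j‖ := by
          rw [hd]
          obtain ⟨c, hc, rfl⟩ := hθ
          refine (Metric.infDist_le_dist_of_mem (s := sgOf X)
            (y := ∑ j, ((⌊(k : ℝ) * c j⌋₊ : ℕ) : ℝ) • X j) ⟨_, rfl⟩).trans ?_
          rw [dist_eq_norm, Finset.smul_sum, ← Finset.sum_sub_distrib]
          refine norm_sum_le_of_le _ fun j _ => ?_
          rw [smul_smul, ← sub_smul, norm_smul]
          have ha : 0 ≤ (k : ℝ) * c j := mul_nonneg (Nat.cast_nonneg _) (hc j)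
          have hb := Nat.floor_le ha
          have hc' := Nat.lt_floor_add_one ((k : ℝ) * c j)
          have : ‖(k : ℝ) * c j - (⌊(k : ℝ) * c j⌋₊ : ℝ)‖ ≤ 1 := by
            rw [Real.norm_eq_abs, abs_le]; constructor <;> linarith
          calc _ ≤ 1 * ‖X j‖ := by gcongr
            _ = _ := one_mul _
        have h3 : ⟪l, z⟫ = k * ⟪l, θ⟫ + ⟪l, z - (k : ℝ) • θ⟫ := by
          rw [inner_sub_right, inner_smul_right]; ring
        have h4 : ⟪l, z - (k : ℝ) • θ⟫ ≤ B := by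
          refine (real_inner_le_norm _ _).trans ?_
          rw [← dist_eq_norm, dist_comm]
          exact mul_le_mul_of_nonneg_left h2 (norm_nonneg _)
        linarith
  have ht : Tendsto (fun k : ℕ => ⟪l, θ⟫ + B / k) atTop (nhds (⟪l, θ⟫ + 0)) :=
    tendsto_const_nhds.add (tendsto_const_div_atTop_nhds_zero_nat _)
  rw [add_zero] at ht
  refine le_of_tendsto_of_tendsto hg ht ?_
  filter_upwards [eventually_gt_atTop 0] with k hk
  have hk0 : (0 : ℝ) < k := by exact_mod_cast hk
  rw [div_le_iff₀ hk0, add_mul, div_mul_cancel₀ _ hk0.ne']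
  linarith [key k]

theorem smul_mem_cone {m : ℕ} (X : Fin m → Euc 2) (z : Euc 2) (hz : z ∈ sgOf X) (r : ℝ)
    (hr : 0 ≤ r) : r • z ∈ coneOf X := by
  obtain ⟨u, rfl⟩ := hz
  refine ⟨fun j => r * u j, fun j => by positivity, ?_⟩
  rw [Finset.smul_sum]
  exact Finset.sum_congr rfl fun j _ => by rw [smul_smul]

theorem PP_le_of_le {m m' : ℕ} (X : Fin m → Euc 2) (Y : Fin m' → Euc 2)
    (hintY : IntegralVecs Y)
    (η : Euc 2) (hηX : ∀ j, ⟪η, X j⟫ = 1)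
    (η' : Euc 2) (hηY : ∀ j, ⟪η', Y j⟫ = 1)
    (hcone : coneOf X = coneOf Y)
    (γ : Euc 2 → ℝ)
    (hγX : ∀ θ ∈ coneOf X, ‖θ‖ = 1 →
      Filter.Tendsto (fun k : ℕ => Real.log (multC X ((k : ℝ) • θ)) / k)
        Filter.atTop (nhds (γ θ)))
    (hγY : ∀ θ ∈ coneOf Y, ‖θ‖ = 1 →
      Filter.Tendsto (fun k : ℕ => Real.log (multC Y ((k : ℝ) • θ)) / k)
        Filter.atTop (nhds (γ θ))) (l : Euc 2) (hl : PP X l ≤ 1) : PP Y l ≤ 1 := by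
  by_contra! hlt
  obtain ⟨z, hz, hzl⟩ := exists_big Y η' hηY l hlt
  have hz0 : z ≠ 0 := by
    rintro rfl
    rw [mult_eq_card Y η' hηY 0 0 (by simp)] at hzl
    simp at hzl
  have hr : 0 < ‖z‖ := norm_pos_iff.2 hz0
  have hm : 0 < mult Y z := by
    have := (Real.exp_pos _).trans hzl
    exact_mod_cast this
  have hθ : ‖z‖⁻¹ • z ∈ coneOf Y := smul_mem_cone Y z hz _ (by positivity)
  have hn : ‖‖z‖⁻¹ • z‖ = 1 := by
    rw [norm_smul, norm_inv, norm_norm, inv_mul_cancel₀ hr.ne']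
  have h1 := gamma_ge Y hintY η' hηY z hz hz0 hm _ (hγY _ hθ hn)
  rw [← hcone] at hθ
  have h2 := gamma_le X η hηX l hl _ hθ _ (hγX _ hθ hn)
  have h3 := h1.trans h2
  rw [inner_smul_right, div_le_iff₀ hr, mul_comm, mul_inv_cancel_left₀ hr.ne'] at h3
  rw [Real.log_le_iff_le_exp (by exact_mod_cast hm)] at h3
  linarith

theorem PP_sub_smul {m : ℕ} (X : Fin m → Euc 2) (η : Euc 2) (hηX : ∀ j, ⟪η, X j⟫ = 1)
    (l : Euc 2) (s : ℝ) : PP X (l - s • η) = Real.exp s * PP X l := by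
  unfold PP
  rw [Finset.mul_sum]
  refine Finset.sum_congr rfl fun j _ => ?_
  rw [← Real.exp_add, inner_sub_left, inner_smul_left, hηX]
  congr 1
  simp
  ring

theorem PP_eq_one {m m' : ℕ} (X : Fin m → Euc 2) (Y : Fin m' → Euc 2)
    (η : Euc 2) (hηX : ∀ j, ⟪η, X j⟫ = 1)
    (h1 : ∀ l, PP X l ≤ 1 → PP Y l ≤ 1) (h2 : ∀ l, PP Y l ≤ 1 → PP X l ≤ 1)
    (l : Euc 2) (hl : PP X l = 1) : PP Y l = 1 := by
  refine le_antisymm (h1 l hl.le) ?_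
  by_contra! hlt
  have hc : Continuous fun s : ℝ => PP Y (l - s • η) := by
    unfold PP
    fun_prop
  have h3 : ∀ᶠ s in 𝓝[>] (0 : ℝ), PP Y (l - s • η) < 1 :=
    (hc.continuousAt (x := 0)).eventually_lt_const (by simpa using hlt) |>.filter_mono
      nhdsWithin_le_nhds
  obtain ⟨s, hs, hs0⟩ := (h3.and self_mem_nhdsWithin).exists
  have h4 := h2 _ hs.le
  rw [PP_sub_smul X η hηX, hl, mul_one, Real.exp_le_one_iff] at h4
  exact absurd hs0 (not_lt.2 h4)

/-- Two-dimensional rigidity of the hyperplane: if `X ⊂ ℤ²` is `η`-coplanar and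
`Y ⊂ ℤ²` is `η'`-coplanar with the same cone and the same directional growth
function, then `η = c·η'` for some `c > 0`. -/
theorem stmt17 {m m' : ℕ} (hm : 2 ≤ m) (hm' : 2 ≤ m')
    (X : Fin m → Euc 2) (Y : Fin m' → Euc 2)
    (hintX : IntegralVecs X) (hintY : IntegralVecs Y)
    (hspanX : Submodule.span ℝ (Set.range X) = ⊤)
    (hspanY : Submodule.span ℝ (Set.range Y) = ⊤)
    (α : Euc 2) (hαX : ∀ j, 0 < ⟪X j, α⟫)
    (α' : Euc 2) (hαY : ∀ j, 0 < ⟪Y j, α'⟫)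
    (η : Euc 2) (hηX : ∀ j, ⟪η, X j⟫ = 1)
    (η' : Euc 2) (hηY : ∀ j, ⟪η', Y j⟫ = 1)
    (hcone : coneOf X = coneOf Y)
    (γ : Euc 2 → ℝ)
    (hγX : ∀ θ ∈ coneOf X, ‖θ‖ = 1 →
      Filter.Tendsto (fun k : ℕ => Real.log (multC X ((k : ℝ) • θ)) / k)
        Filter.atTop (nhds (γ θ)))
    (hγY : ∀ θ ∈ coneOf Y, ‖θ‖ = 1 →
      Filter.Tendsto (fun k : ℕ => Real.log (multC Y ((k : ℝ) • θ)) / k)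
        Filter.atTop (nhds (γ θ))) :
    ∃ c : ℝ, 0 < c ∧ η = c • η' := by
  have i2 : ∀ a b : Euc 2, ⟪a, b⟫ = a 0 * b 0 + a 1 * b 1 := fun a b => by
    simp [PiLp.inner_apply, Fin.sum_univ_two, mul_comm]
  have hXY := PP_le_of_le X Y hintY η hηX η' hηY hcone γ hγX hγY
  have hYX := PP_le_of_le Y X hintX η' hηY η hηX hcone.symm γ hγY hγX
  have hcurve := PP_eq_one X Y η hηX hXY hYX
  -- positivity of `η` on `Y`
  have hpos : ∀ j, 0 < ⟪η, Y j⟫ := by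
    intro j
    have hj : Y j ∈ coneOf X := by
      rw [hcone]
      refine ⟨Pi.single j 1, fun i => ?_, ?_⟩
      · by_cases h : i = j
        · subst h; simp
        · simp [h]
      · rw [Finset.sum_eq_single j] <;> simp +contextual
    obtain ⟨c, hc, hcs⟩ := hj
    have h1 : ⟪η, Y j⟫ = ∑ i, c i := by
      rw [← hcs, inner_sum]
      simp [inner_smul_right, hηX]
    have h0 : 0 ≤ ∑ i, c i := Finset.sum_nonneg fun i _ => hc i
    rw [h1]
    refine lt_of_le_of_ne h0 fun h => ?_
    have h2 := (Finset.sum_eq_zero_iff_of_nonneg fun i _ => hc i).1 h.symm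
    have h3 : Y j = 0 := by
      rw [← hcs]
      exact Finset.sum_eq_zero fun i hi => by rw [h2 i hi, zero_smul]
    have := hηY j
    rw [h3] at this
    simp at this
  by_contra hcon
  let jy : Fin m' := ⟨0, by omega⟩
  have hdet : η 0 * η' 1 - η 1 * η' 0 ≠ 0 := by
    intro hd
    apply hcon
    refine ⟨⟪η, Y jy⟫, hpos jy, ?_⟩
    have h1 := hηY jy
    rw [i2] at h1 ⊢
    ext i
    fin_cases i
    · simp only [Fin.zero_eta, PiLp.smul_apply, smul_eq_mul]
      linear_combination (-η 0) * h1 + (Y jy 1) * hd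
    · simp only [Fin.mk_one, PiLp.smul_apply, smul_eq_mul]
      linear_combination (-η 1) * h1 - (Y jy 0) * hd
  -- two distinct points of `X`
  obtain ⟨j₁, j₂, hj⟩ : ∃ j₁ j₂, X j₁ ≠ X j₂ := by
    by_contra! hall
    let jx : Fin m := ⟨0, by omega⟩
    let u : Euc 2 := !₂[-(X jx 1), X jx 0]
    have hu : ∀ x ∈ Submodule.span ℝ (Set.range X), ⟪u, x⟫ = 0 := by
      intro x hx
      induction hx using Submodule.span_induction with
      | mem x h =>
        obtain ⟨j, rfl⟩ := h
        rw [hall j jx, i2]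
        simp [u]; ring
      | zero => simp
      | add x y _ _ hx hy => rw [inner_add_right, hx, hy, add_zero]
      | smul a x _ hx => rw [inner_smul_right, hx, mul_zero]
    have h0 : u = 0 := by
      have := hu u (by rw [hspanX]; trivial)
      exact inner_self_eq_zero.1 this
    have h1 : u 0 = 0 := by rw [h0]; rfl
    have h2 : u 1 = 0 := by rw [h0]; rfl
    have h3 := hηX jx
    rw [i2] at h3
    simp only [u, PiLp.toLp_apply, Matrix.cons_val_zero, Matrix.cons_val_one] at h1 h2
    have h1' : X jx 1 = 0 := by linarith
    rw [h1', h2] at h3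
    simp at h3
  choose x hx using hintX
  choose y hy using hintY
  set p : ℤ := x j₂ 0 - x j₁ 0 with hp
  set q : ℤ := x j₂ 1 - x j₁ 1 with hq
  have hpq : 0 < p ^ 2 + q ^ 2 := by
    by_contra! hle
    have hp0 : p = 0 := by nlinarith [sq_nonneg p, sq_nonneg q]
    have hq0 : q = 0 := by nlinarith [sq_nonneg p, sq_nonneg q]
    apply hj
    ext i
    rw [hx, hx]
    fin_cases i
    · simp only [Fin.zero_eta]; congr 1; omega
    · simp only [Fin.mk_one]; congr 1; omega
  set D0 : ℤ := p * x j₁ 1 - q * x j₁ 0 with hD0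
  have e1 := hηX j₁
  have e2 := hηX j₂
  rw [i2, hx, hx] at e1 e2
  have eq0 : (D0 : ℝ) * η 0 = -q := by
    rw [hD0, hp, hq]; push_cast
    linear_combination (x j₁ 1 : ℝ) * (e2 - e1) + (-(x j₂ 1 : ℝ) + x j₁ 1) * e1
  have eq1 : (D0 : ℝ) * η 1 = p := by
    rw [hD0, hp, hq]; push_cast
    linear_combination (-(x j₁ 0 : ℝ)) * (e2 - e1) + ((x j₂ 0 : ℝ) - x j₁ 0) * e1
  have hD0ne : D0 ≠ 0 := by
    intro h0
    rw [h0] at eq0 eq1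
    have a1 : (q : ℝ) = 0 := by simpa using eq0.symm
    have a2 : (p : ℝ) = 0 := by simpa using eq1.symm
    have a3 : q = 0 := by exact_mod_cast a1
    have a4 : p = 0 := by exact_mod_cast a2
    rw [a3, a4] at hpq
    simp at hpq
  obtain ⟨D, z0, z1, hD, hz0, hz1⟩ : ∃ (D : ℕ) (z0 z1 : ℤ), 0 < D ∧ (D : ℝ) * η 0 = z0 ∧
      (D : ℝ) * η 1 = z1 := by
    have hab : ((D0.natAbs : ℕ) : ℝ) = |(D0 : ℝ)| := by simp
    rcases lt_or_gt_of_ne hD0ne with h | h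
    · refine ⟨D0.natAbs, q, -p, Int.natAbs_pos.2 hD0ne, ?_, ?_⟩
      · rw [hab, abs_of_neg (by exact_mod_cast h)]; linarith
      · rw [hab, abs_of_neg (by exact_mod_cast h)]; push_cast; linarith
    · refine ⟨D0.natAbs, -q, p, Int.natAbs_pos.2 hD0ne, ?_, ?_⟩
      · rw [hab, abs_of_pos (by exact_mod_cast h)]; push_cast; linarith
      · rw [hab, abs_of_pos (by exact_mod_cast h)]; linarith
  have hDR : (0 : ℝ) < D := by exact_mod_cast hD
  -- the exponents `n`
  have hnex : ∀ j, ∃ n : ℕ, 0 < n ∧ (D : ℝ) * ⟪η, Y j⟫ = n := by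
    intro j
    have h1 : (D : ℝ) * ⟪η, Y j⟫ = ((z0 * y j 0 + z1 * y j 1 : ℤ) : ℝ) := by
      rw [i2, hy, hy]; push_cast
      linear_combination (y j 0 : ℝ) * hz0 + (y j 1 : ℝ) * hz1
    have h2 : (0 : ℝ) < ((z0 * y j 0 + z1 * y j 1 : ℤ) : ℝ) := by
      rw [← h1]; exact mul_pos hDR (hpos j)
    have h3 : 0 < z0 * y j 0 + z1 * y j 1 := by exact_mod_cast h2
    obtain ⟨n, hn⟩ := Int.eq_ofNat_of_zero_le h3.le
    refine ⟨n, by omega, ?_⟩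
    rw [h1, hn]; simp
  choose n hn hnD using hnex
  -- the exponents `e`, `d`
  set K : ℕ := ∑ j, (p * x j 0 + q * x j 1).natAbs + ∑ j, (p * y j 0 + q * y j 1).natAbs with hK
  let v : Euc 2 := !₂[(p : ℝ) + K * z0, (q : ℝ) + K * z1]
  have hv : ∀ u, ⟪v, u⟫ = p * u 0 + q * u 1 + K * (D * ⟪η, u⟫) := by
    intro u
    rw [i2, i2]
    simp only [v, PiLp.toLp_apply, Matrix.cons_val_zero, Matrix.cons_val_one]
    rw [← hz0, ← hz1]; ring
  have heex : ∀ j, ∃ e : ℕ, ⟪v, X j⟫ = e := by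
    intro j
    have h1 : (p * x j 0 + q * x j 1).natAbs ≤ K :=
      (Finset.single_le_sum (f := fun j => (p * x j 0 + q * x j 1).natAbs)
        (fun _ _ => Nat.zero_le _) (Finset.mem_univ j)).trans (Nat.le_add_right _ _)
    have h2 : (K : ℤ) * 1 ≤ K * D := by
      apply mul_le_mul_of_nonneg_left <;> omega
    obtain ⟨e, he⟩ := Int.eq_ofNat_of_zero_le (a := p * x j 0 + q * x j 1 + K * D) (by omega)
    refine ⟨e, ?_⟩
    rw [hv, hx, hx, hηX]
    have : ((p * x j 0 + q * x j 1 + K * D : ℤ) : ℝ) = e := by rw [he]; simp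
    push_cast at this
    linarith
  have hdex : ∀ j, ∃ d : ℕ, ⟪v, Y j⟫ = d := by
    intro j
    have h1 : (p * y j 0 + q * y j 1).natAbs ≤ K :=
      (Finset.single_le_sum (f := fun j => (p * y j 0 + q * y j 1).natAbs)
        (fun _ _ => Nat.zero_le _) (Finset.mem_univ j)).trans (Nat.le_add_left _ _)
    have hnj := hn j
    have h2 : (K : ℤ) * 1 ≤ K * n j := by
      apply mul_le_mul_of_nonneg_left <;> omega
    obtain ⟨e, he⟩ := Int.eq_ofNat_of_zero_le (a := p * y j 0 + q * y j 1 + K * n j) (by omega)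
    refine ⟨e, ?_⟩
    rw [hv, hy, hy, hnD]
    have : ((p * y j 0 + q * y j 1 + K * n j : ℤ) : ℝ) = e := by rw [he]; simp
    push_cast at this
    linarith
  choose e he using heex
  choose d hd using hdex
  obtain ⟨j₀, -, hj₀⟩ := Finset.exists_max_image Finset.univ n ⟨jy, Finset.mem_univ _⟩
  refine alg_contra e j₁ j₂ ?_ n d D hD (n j₀) hn (fun j => hj₀ j (Finset.mem_univ _)) j₀ rfl ?_ ?_
  · intro hee
    have h1 := he j₁
    have h2 := he j₂
    rw [← hee, ← h1, hv, hv, hηX, hηX, hx, hx, hx, hx] at h2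
    have h3 : ((p ^ 2 + q ^ 2 : ℤ) : ℝ) = 0 := by
      rw [hp, hq]
      rw [hp, hq] at h2
      push_cast at h2 ⊢
      linarith
    have h4 : p ^ 2 + q ^ 2 = 0 := by exact_mod_cast h3
    omega
  · intro j hnj
    have h1 : ⟪η, Y j⟫ = ⟪η, Y j₀⟫ := by
      have a := hnD j
      rw [hnj, ← hnD j₀] at a
      exact mul_left_cancel₀ hDR.ne' a
    have h2 : ⟪η', Y j⟫ = ⟪η', Y j₀⟫ := by rw [hηY, hηY]
    rw [i2, i2] at h1 h2
    have h3 : Y j 0 = Y j₀ 0 := by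
      apply mul_left_cancel₀ hdet
      linear_combination (η' 1) * h1 - (η 1) * h2
    have h4 : Y j 1 = Y j₀ 1 := by
      apply mul_left_cancel₀ hdet
      linear_combination (η 0) * h2 - (η' 0) * h1
    have h5 : (d j : ℝ) = d j₀ := by
      rw [← hd, ← hd, i2, i2, h3, h4]
    exact_mod_cast h5
  · intro t w ht hw hF
    have h1 := hcurve ((D * Real.log w) • η - (Real.log t) • v) ?_
    · unfold PP at h1
      rw [← mul_one (w ^ n j₀), ← h1, Finset.mul_sum]
      refine Finset.sum_congr rfl fun j _ => ?_
      have h2 : -⟪(D * Real.log w) • η - (Real.log t) • v, Y j⟫ =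
          Real.log t * d j - Real.log w * n j := by
        rw [inner_sub_left, real_inner_smul_left, real_inner_smul_left, hd, ← hnD]; ring
      rw [h2, Real.exp_sub, mul_comm (Real.log t), mul_comm (Real.log w), Real.exp_nat_mul,
        Real.exp_nat_mul, Real.exp_log ht, Real.exp_log hw]
      have h3 : w ^ n j₀ = w ^ (n j₀ - n j) * w ^ n j := by
        rw [← pow_add, Nat.sub_add_cancel (hj₀ j (Finset.mem_univ _))]
      rw [h3]
      have : w ^ n j ≠ 0 := (pow_pos hw _).ne'
      field_simp
    · unfold PP
      have h2 : ∀ j, Real.exp (-⟪(D * Real.log w) • η - (Real.log t) • v, X j⟫) =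
          t ^ e j / w ^ D := by
        intro j
        have h2 : -⟪(D * Real.log w) • η - (Real.log t) • v, X j⟫ =
            e j * Real.log t - D * Real.log w := by
          rw [inner_sub_left, real_inner_smul_left, real_inner_smul_left, he, hηX]; ring
        rw [h2, Real.exp_sub, Real.exp_nat_mul, Real.exp_nat_mul, Real.exp_log ht, Real.exp_log hw]
      rw [Finset.sum_congr rfl fun j _ => h2 j, ← Finset.sum_div, ← hF]
      exact div_self (pow_pos hw _).ne'
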